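/- The involution ν_n on C_*(P_n) defined by ν_n[ψ₁|ψ₂|…|ψ_d] = −(−1)^{n(d−1) + (d−1)(d−2)/2 + Σ_{i<j} m_i m_j} [ψ_d|ψ_{d−1}|…|ψ₁] (where m_i = #ψ_i) satisfies ν_n² = id, commutes with the cellular differential ∂, and commutes with the signed Σ_n-action. -/

import Mathlib

open Finset

noncomputable section

variable (K : Type*) [Field K] [CharZero K] (n : ℕ)

/-- Ordered partitions of `{1,…,n}`, encoded as lists of nonempty pairwise disjoint
subsets of `Fin n` covering everything. -/
def IsOP (l : List (Finset (Fin n))) : Prop :=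
  (∀ s ∈ l, s ≠ ∅) ∧ l.Pairwise Disjoint ∧ ∀ x : Fin n, ∃ s ∈ l, x ∈ s

/-- The cellular boundary operator of the permutahedron (with unshuffle signs). -/
def permBd : (List (Finset (Fin n)) →₀ K) →ₗ[K] (List (Finset (Fin n)) →₀ K) :=
  Finsupp.lsum K fun l =>
    ∑ j ∈ Finset.range l.length,
      ∑ M ∈ (l.getD j ∅).powerset.filter (fun M => M ≠ ∅ ∧ M ≠ l.getD j ∅),
        ((-1 : K) ^ (((l.take j).map Finset.card).sum + j + M.card +
            ∑ a ∈ M, (((l.getD j ∅) \ M).filter (· < a)).card)) •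
          Finsupp.lsingle (l.take j ++ [M, (l.getD j ∅) \ M] ++ l.drop (j + 1))

/-- The sign of `σ` acting on the ordered partition `l` (parity of the number of
`σ`-inversions inside the parts). -/
def permActSgn (σ : Equiv.Perm (Fin n)) (l : List (Finset (Fin n))) : K :=
  (-1 : K) ^ (l.map fun s =>
    ((Finset.univ : Finset (Fin n × Fin n)).filter fun p =>
      p.1 ∈ s ∧ p.2 ∈ s ∧ p.1 < p.2 ∧ σ p.2 < σ p.1).card).sum

/-- The signed action of the symmetric group on the span of ordered partitions. -/
def permAct (σ : Equiv.Perm (Fin n)) :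
    (List (Finset (Fin n)) →₀ K) →ₗ[K] (List (Finset (Fin n)) →₀ K) :=
  Finsupp.lsum K fun l =>
    permActSgn K n σ l • Finsupp.lsingle (l.map (Finset.image σ))

/-- The involution
`ν_n[ψ₁|…|ψ_d] = -(-1)^{n(d-1) + (d-1)(d-2)/2 + Σ_{i<j} m_i m_j} [ψ_d|…|ψ₁]`. -/
def permNu : (List (Finset (Fin n)) →₀ K) →ₗ[K] (List (Finset (Fin n)) →₀ K) :=
  Finsupp.lsum K fun l =>
    (-(-1 : K) ^ (n * (l.length - 1) + (l.length - 1) * (l.length - 2) / 2 +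
        ∑ p ∈ ((Finset.range l.length ×ˢ Finset.range l.length).filter
          fun p => p.1 < p.2), (l.getD p.1 ∅).card * (l.getD p.2 ∅).card)) •
      Finsupp.lsingle l.reverse

theorem neg_one_pow_eq_of_even_add {R : Type*} [Ring R] {a b : ℕ} (h : Even (a + b)) :
    (-1 : R) ^ a = (-1) ^ b := by
  rw [neg_one_pow_congr]
  exact Nat.even_add.mp h

theorem sum_map_eq_sum_range_getD {α : Type*} (d : α) (g : α → ℕ) (l : List α) :
    (l.map g).sum = ∑ i ∈ Finset.range l.length, g (l.getD i d) := by
  induction l with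
  | nil => simp
  | cons a t ih =>
    rw [List.length_cons, Finset.sum_range_succ']
    simp [ih, add_comm]

/-- The sum of `m_i m_j` over all pairs `i < j` of parts. -/
def pairSum {n : ℕ} (l : List (Finset (Fin n))) : ℕ :=
  ∑ p ∈ ((Finset.range l.length ×ˢ Finset.range l.length).filter
    fun p => p.1 < p.2), (l.getD p.1 ∅).card * (l.getD p.2 ∅).card

theorem two_mul_sum_lt_add_sum_sq (f : ℕ → ℕ) (d : ℕ) :
    2 * ∑ p ∈ (Finset.range d ×ˢ Finset.range d).filter (fun p => p.1 < p.2), f p.1 * f p.2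
      + ∑ i ∈ Finset.range d, f i ^ 2 = (∑ i ∈ Finset.range d, f i) ^ 2 := by
  rw [Finset.sum_filter, Finset.sum_product]
  induction d with
  | zero => simp
  | succ d ih =>
    have h : ∀ x ∈ Finset.range d,
        ∑ y ∈ Finset.range (d + 1), (if x < y then f x * f y else 0)
          = ∑ y ∈ Finset.range d, (if x < y then f x * f y else 0) + f x * f d := by
      intro x hx
      rw [Finset.sum_range_succ, if_pos (Finset.mem_range.mp hx)]
    have h' : ∑ y ∈ Finset.range (d + 1), (if d < y then f d * f y else 0) = 0 := by
      refine Finset.sum_eq_zero fun y hy => if_neg ?_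
      have := Finset.mem_range.mp hy
      omega
    rw [Finset.sum_range_succ, h', Finset.sum_congr rfl h, Finset.sum_add_distrib,
      ← Finset.sum_mul, Finset.sum_range_succ, Finset.sum_range_succ, add_sq, ← ih]
    ring

theorem two_mul_pairSum {n : ℕ} (l : List (Finset (Fin n))) :
    2 * pairSum l + (l.map fun s => s.card ^ 2).sum = (l.map Finset.card).sum ^ 2 := by
  rw [sum_map_eq_sum_range_getD ∅, sum_map_eq_sum_range_getD ∅]
  exact two_mul_sum_lt_add_sum_sq (fun i => (l.getD i ∅).card) l.length

theorem pairSum_reverse {n : ℕ} (l : List (Finset (Fin n))) :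
    pairSum l.reverse = pairSum l := by
  have h₁ := two_mul_pairSum l.reverse
  have h₂ := two_mul_pairSum l
  simp only [List.map_reverse, List.sum_reverse] at h₁
  omega

theorem pairSum_map_image {n : ℕ} (σ : Equiv.Perm (Fin n)) (l : List (Finset (Fin n))) :
    pairSum (l.map (Finset.image σ)) = pairSum l := by
  have h₁ := two_mul_pairSum (l.map (Finset.image σ))
  have h₂ := two_mul_pairSum l
  simp only [List.map_map, Function.comp_def, Finset.card_image_of_injective _ σ.injective] at h₁
  have h₃ := h₁.trans h₂.symm
  omega

theorem pairSum_split {n : ℕ} (A B : List (Finset (Fin n))) {s M : Finset (Fin n)} (hM : M ⊆ s) :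
    pairSum (A ++ [M, s \ M] ++ B) = pairSum (A ++ s :: B) + M.card * (s \ M).card := by
  have h₁ := two_mul_pairSum (A ++ [M, s \ M] ++ B)
  have h₂ := two_mul_pairSum (A ++ s :: B)
  have h₃ : (s \ M).card + M.card = s.card := Finset.card_sdiff_add_card_eq_card hM
  simp only [List.map_append, List.map_cons, List.map_nil, List.sum_append, List.sum_cons,
    List.sum_nil, ← h₃] at h₁ h₂
  nlinarith

/-- The exponent of the sign of `permNu`. -/
def nuExp (n : ℕ) (l : List (Finset (Fin n))) : ℕ :=
  n * (l.length - 1) + (l.length - 1) * (l.length - 2) / 2 + pairSum l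

theorem nuExp_reverse (n : ℕ) (l : List (Finset (Fin n))) : nuExp n l.reverse = nuExp n l := by
  simp [nuExp, pairSum_reverse]

theorem nuExp_map_image (n : ℕ) (σ : Equiv.Perm (Fin n)) (l : List (Finset (Fin n))) :
    nuExp n (l.map (Finset.image σ)) = nuExp n l := by
  simp [nuExp, pairSum_map_image]

theorem nuExp_split (n : ℕ) (A B : List (Finset (Fin n))) {s M : Finset (Fin n)} (hM : M ⊆ s) :
    nuExp n (A ++ [M, s \ M] ++ B) =
      nuExp n (A ++ s :: B) + n + (A.length + B.length) + M.card * (s \ M).card := by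
  have h := Nat.triangle_succ (A.length + B.length)
  have e₁ : (A ++ [M, s \ M] ++ B).length = A.length + B.length + 2 := by simp; omega
  have e₂ : (A ++ s :: B).length = A.length + B.length + 1 := by simp; omega
  rw [nuExp, nuExp, pairSum_split A B hM, e₁, e₂]
  simp only [Nat.add_sub_cancel, Nat.reduceSubDiff] at h ⊢
  rw [h]
  ring

/-- The number of pairs `(a, b) ∈ M × N` with `b < a`. -/
def crossInv {n : ℕ} (M N : Finset (Fin n)) : ℕ := ∑ a ∈ M, (N.filter (· < a)).card

theorem crossInv_add_crossInv {n : ℕ} {M N : Finset (Fin n)} (h : Disjoint M N) :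
    crossInv M N + crossInv N M = M.card * N.card := by
  have e : crossInv N M = ∑ a ∈ M, (N.filter (a < ·)).card := by
    simp only [crossInv, Finset.card_filter]
    exact Finset.sum_comm
  rw [e, crossInv, ← Finset.sum_add_distrib, ← smul_eq_mul, ← Finset.sum_const]
  refine Finset.sum_congr rfl fun a ha => ?_
  rw [← Finset.card_union_of_disjoint, ← Finset.filter_or, Finset.filter_true_of_mem]
  · intro b hb
    exact lt_or_gt_of_ne (Finset.disjoint_left.mp h ha <| · ▸ hb)
  · exact Finset.disjoint_filter.mpr fun b _ h₁ h₂ => lt_asymm h₁ h₂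

theorem permNu_single (l : List (Finset (Fin n))) :
    permNu K n (Finsupp.single l 1) = (-(-1 : K) ^ nuExp n l) • Finsupp.single l.reverse 1 := by
  simp [permNu, nuExp, pairSum]

theorem permAct_single (σ : Equiv.Perm (Fin n)) (l : List (Finset (Fin n))) :
    permAct K n σ (Finsupp.single l 1) =
      permActSgn K n σ l • Finsupp.single (l.map (Finset.image σ)) 1 := by
  simp [permAct]

theorem permActSgn_reverse (σ : Equiv.Perm (Fin n)) (l : List (Finset (Fin n))) :
    permActSgn K n σ l.reverse = permActSgn K n σ l := by
  simp [permActSgn, List.sum_reverse]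

/-- The part of the boundary of `[A|s|B]` obtained by splitting `s`. -/
def splitBd (A : List (Finset (Fin n))) (s : Finset (Fin n)) (B : List (Finset (Fin n))) :
    List (Finset (Fin n)) →₀ K :=
  ∑ M ∈ s.powerset.filter (fun M => M ≠ ∅ ∧ M ≠ s),
    ((-1 : K) ^ ((A.map Finset.card).sum + A.length + M.card + crossInv M (s \ M))) •
      Finsupp.single (A ++ [M, s \ M] ++ B) 1

theorem permBd_single (l : List (Finset (Fin n))) :
    permBd K n (Finsupp.single l 1) =
      ∑ j ∈ Finset.range l.length, splitBd K n (l.take j) (l.getD j ∅) (l.drop (j + 1)) := by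
  rw [permBd, Finsupp.lsum_single, LinearMap.sum_apply]
  refine Finset.sum_congr rfl fun j hj => ?_
  rw [LinearMap.sum_apply, splitBd, List.length_take_of_le (Finset.mem_range.mp hj).le]
  rfl

theorem sum_card_eq_of_isOP {l : List (Finset (Fin n))} (h : IsOP n l) :
    (l.map Finset.card).sum = n := by
  have key : ∀ l : List (Finset (Fin n)), l.Pairwise Disjoint →
      (l.map Finset.card).sum = (Finset.univ.filter fun x => ∃ s ∈ l, x ∈ s).card := by
    intro l hl
    induction l with
    | nil => simp
    | cons s t ih =>
      rw [List.pairwise_cons] at hl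
      rw [List.map_cons, List.sum_cons, ih hl.2, ← Finset.card_union_of_disjoint]
      · congr 1
        ext x
        simp
      · rw [Finset.disjoint_left]
        intro x hx hx'
        obtain ⟨u, hu, hxu⟩ := (Finset.mem_filter.mp hx').2
        exact Finset.disjoint_left.mp (hl.1 u hu) hx hxu
  rw [key l h.2.1, Finset.filter_true_of_mem fun x _ => h.2.2 x, Finset.card_univ,
    Fintype.card_fin]

theorem permNu_splitBd (A B : List (Finset (Fin n))) (s : Finset (Fin n))
    (h : ((A ++ s :: B).map Finset.card).sum = n) :
    permNu K n (splitBd K n A s B) =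
      (-(-1 : K) ^ nuExp n (A ++ s :: B)) • splitBd K n B.reverse s A.reverse := by
  rw [splitBd, splitBd, map_sum, Finset.smul_sum]
  have hmaps : ∀ M ∈ s.powerset.filter (fun M => M ≠ ∅ ∧ M ≠ s),
      s \ M ∈ s.powerset.filter (fun M => M ≠ ∅ ∧ M ≠ s) := by
    intro M hM
    simp only [Finset.mem_filter, Finset.mem_powerset] at hM ⊢
    refine ⟨Finset.sdiff_subset, fun h0 => hM.2.2 ?_, fun h0 => hM.2.1 ?_⟩
    · exact hM.1.antisymm (Finset.sdiff_eq_empty_iff_subset.mp h0)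
    · rw [← Finset.sdiff_sdiff_eq_self hM.1, h0, Finset.sdiff_self]
  have hinv : ∀ M ∈ s.powerset.filter (fun M => M ≠ ∅ ∧ M ≠ s), s \ (s \ M) = M := fun M hM =>
    Finset.sdiff_sdiff_eq_self (Finset.mem_powerset.mp (Finset.mem_filter.mp hM).1)
  refine Finset.sum_nbij' (s \ ·) (s \ ·) hmaps hmaps hinv hinv fun M hM => ?_
  have hMs : M ⊆ s := Finset.mem_powerset.mp (Finset.mem_filter.mp hM).1
  have hcard : (s \ M).card + M.card = s.card := Finset.card_sdiff_add_card_eq_card hMs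
  have hcross := crossInv_add_crossInv (Finset.disjoint_sdiff : Disjoint M (s \ M))
  simp only [List.map_append, List.map_cons, List.sum_append, List.sum_cons] at h
  have hlist : (A ++ [M, s \ M] ++ B).reverse = B.reverse ++ [s \ M, M] ++ A.reverse := by simp
  rw [map_smul, permNu_single, hinv M hM, smul_smul, smul_smul, hlist, mul_neg, neg_mul,
    ← pow_add, ← pow_add]
  congr 2
  refine neg_one_pow_eq_of_even_add ?_
  rw [nuExp_split n A B hMs, ← hcross, List.map_reverse, List.sum_reverse, List.length_reverse,
    Nat.even_iff]
  omega

theorem permNu_permBd_single {l : List (Finset (Fin n))} (h : (l.map Finset.card).sum = n) :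
    permNu K n (permBd K n (Finsupp.single l 1)) =
      permBd K n (permNu K n (Finsupp.single l 1)) := by
  rw [permNu_single, map_smul, permBd_single, permBd_single, map_sum, Finset.smul_sum,
    List.length_reverse,
    ← Finset.sum_range_reflect (fun j => _ • splitBd K n (l.reverse.take j) _ _)]
  refine Finset.sum_congr rfl fun j hj => ?_
  have hj : j < l.length := Finset.mem_range.mp hj
  have hl : l.take j ++ l.getD j ∅ :: l.drop (j + 1) = l := by
    rw [List.getD_eq_getElem _ _ hj, List.getElem_cons_drop, List.take_append_drop]
  rw [permNu_splitBd K n _ _ _ (hl.symm ▸ h), hl]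
  congr 2
  · rw [List.take_reverse]
    congr 2
    omega
  · rw [List.getD_eq_getElem _ _ hj, List.getD_eq_getElem _ _ (by simp; omega),
      List.getElem_reverse]
    congr 1
    omega
  · rw [List.drop_reverse]
    congr 2
    omega

/- STATEMENT 7: ν_n is an involution of C_*(P_n) commuting with the cellular boundary
operator and with the signed Σ_n-action. -/
theorem stmt7 :
    (∀ l : List (Finset (Fin n)), IsOP n l →
      permNu K n (permNu K n (Finsupp.single l 1)) = Finsupp.single l 1) ∧
    (∀ l : List (Finset (Fin n)), IsOP n l →
      permNu K n (permBd K n (Finsupp.single l 1)) =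
        permBd K n (permNu K n (Finsupp.single l 1))) ∧
    (∀ σ : Equiv.Perm (Fin n), ∀ l : List (Finset (Fin n)), IsOP n l →
      permNu K n (permAct K n σ (Finsupp.single l 1)) =
        permAct K n σ (permNu K n (Finsupp.single l 1))) := by
  refine ⟨fun l _ => ?_, fun l h => permNu_permBd_single K n (sum_card_eq_of_isOP n h),
    fun σ l _ => ?_⟩
  · rw [permNu_single, map_smul, permNu_single, nuExp_reverse, smul_smul, List.reverse_reverse,
      neg_mul_neg, ← pow_add, Even.neg_one_pow ⟨_, rfl⟩, one_smul]
  · rw [permAct_single, permNu_single, map_smul, map_smul, permNu_single, permAct_single,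
      nuExp_map_image, permActSgn_reverse, List.map_reverse, smul_comm]

end
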